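/- Let n, t, d be positive integers and let G be a simple graph on n vertices that is triangle-free and has independence number α(G) < t. Let Δ denote the maximum degree and δ the minimum degree of G. If Δ − δ ≤ d and 9·d ≤ 4·⌊n/(Δ+1)⌋, then there exists a simple graph G' on 2n vertices that is triangle-free, is (d+Δ)-regular, and has independence number α(G') < 2t − 1. -/

import Mathlib

section HSpart
open Classical

lemma gr_arith (d a b i e M : ℕ) (hM : M = a + b + i + e) (h : 9 * d ≤ 4 * M) :
    2 * d * a ≤ d * b + (a + i) * (a + e) := by
  subst hM
  zify at *
  have ha : (0:ℤ) ≤ a := by positivity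
  have hb : (0:ℤ) ≤ b := by positivity
  have hi : (0:ℤ) ≤ i := by positivity
  have he : (0:ℤ) ≤ e := by positivity
  have hd : (0:ℤ) ≤ d := by positivity
  generalize (a:ℤ) = a at *
  generalize (b:ℤ) = b at *
  generalize (i:ℤ) = i at *
  generalize (e:ℤ) = e at *
  generalize (d:ℤ) = d at *
  by_cases h1 : a + i ≤ d
  · by_cases h2 : a + e ≤ d
    · nlinarith [mul_nonneg (sub_nonneg.2 h1) (sub_nonneg.2 h2), mul_nonneg hd hi, mul_nonneg hd he, mul_nonneg hd ha]
    · push Not at h2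
      nlinarith [mul_nonneg (sub_nonneg.2 h1) hb, mul_nonneg hd hi, mul_nonneg hd he, mul_nonneg hd ha, mul_nonneg ha hi, mul_nonneg ha he, mul_nonneg hi he, mul_nonneg (add_nonneg ha hi) hd, mul_nonneg (add_nonneg ha hi) (sub_nonneg.2 h)]
  · push Not at h1
    by_cases h2 : a + e ≤ d
    · nlinarith [mul_nonneg (sub_nonneg.2 h2) hb, mul_nonneg hd hi, mul_nonneg hd he, mul_nonneg hd ha, mul_nonneg ha hi, mul_nonneg ha he, mul_nonneg hi he, mul_nonneg (add_nonneg ha he) hd, mul_nonneg (add_nonneg ha he) (sub_nonneg.2 h)]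
    · push Not at h2
      rcases le_total i e with h3 | h3
      · nlinarith [sq_nonneg (2 * (a + i) - 3 * d), mul_nonneg (sub_nonneg.2 h1.le) (sub_nonneg.2 h3), mul_nonneg hd hi, mul_nonneg hd (sub_nonneg.2 h)]
      · nlinarith [sq_nonneg (2 * (a + e) - 3 * d), mul_nonneg (sub_nonneg.2 h2.le) (sub_nonneg.2 h3), mul_nonneg hd he, mul_nonneg hd (sub_nonneg.2 h)]

lemma gr_cut {ι : Type} [Fintype ι] (d : ℕ) (f : ι → ℕ) (h1 : ∀ v, d ≤ f v)
    (h2 : ∀ v, f v ≤ 2 * d) (hM : 9 * d ≤ 4 * Fintype.card ι) (X Y : Finset ι) :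
    ∑ v ∈ Y, f v ≤ ∑ v ∈ X, f v + Y.card * (Fintype.card ι - X.card) := by
  have eY := Finset.sum_inter_add_sum_sdiff Y X f
  have eX := Finset.sum_inter_add_sum_sdiff X Y f
  have cY := Finset.card_inter_add_card_sdiff Y X
  have cX := Finset.card_inter_add_card_sdiff X Y
  rw [Finset.inter_comm X Y] at eX cX
  have l1 : ∑ v ∈ Y \ X, f v ≤ (Y \ X).card * (2 * d) := by
    simpa using Finset.sum_le_card_nsmul _ _ _ (fun v _ => h2 v)
  have l2 : (X \ Y).card * d ≤ ∑ v ∈ X \ Y, f v := by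
    simpa using Finset.card_nsmul_le_sum _ _ _ (fun v _ => h1 v)
  have hu : (Y ∪ X).card ≤ Fintype.card ι := Finset.card_le_univ _
  have hu2 := Finset.card_union_add_card_inter Y X
  obtain ⟨e, he⟩ : ∃ e, Fintype.card ι = (Y \ X).card + (X \ Y).card + (Y ∩ X).card + e :=
    ⟨Fintype.card ι - ((Y \ X).card + (X \ Y).card + (Y ∩ X).card), by omega⟩
  have key := gr_arith d _ _ _ _ _ he hM
  have e1 : Fintype.card ι - X.card = (Y \ X).card + e := by omega
  have e2 : Y.card = (Y \ X).card + (Y ∩ X).card := by omega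
  rw [e1, e2]
  nlinarith

abbrev SlotTy {ι : Type} (M : ℕ) (f : ι → ℕ) : Type :=
  (Σ u : ι, Fin (M - f u)) ⊕ (Σ w : ι, Fin (f w))

lemma gale_ryser {ι : Type} [Fintype ι] (d : ℕ) (f : ι → ℕ) (h1 : ∀ v, d ≤ f v)
    (h2 : ∀ v, f v ≤ 2 * d) (hM : 9 * d ≤ 4 * Fintype.card ι) :
    ∃ R : ι → ι → Prop, (∀ u, (Finset.univ.filter (fun w => R u w)).card = f u) ∧
      (∀ w, (Finset.univ.filter (fun u => R u w)).card = f w) := by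
  set M := Fintype.card ι with hMdef
  have hfM : ∀ v, f v ≤ M := fun v => by have := h2 v; omega
  let nb : SlotTy M f → Finset (ι × ι) := fun x => match x with
    | Sum.inl p => Finset.univ.filter (fun q => q.1 = p.1)
    | Sum.inr p => Finset.univ.filter (fun q => q.2 = p.1)
  have cardL : Fintype.card (SlotTy M f) = Fintype.card (ι × ι) := by
    simp only [SlotTy, Fintype.card_sum, Fintype.card_sigma, Fintype.card_fin, Fintype.card_prod]
    rw [← Finset.sum_add_distrib, Finset.sum_congr rfl (fun v _ => Nat.sub_add_cancel (hfM v))]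
    simp [hMdef]
  have hall : ∀ s : Finset (SlotTy M f), s.card ≤ (s.biUnion nb).card := by
    intro s
    let X : Finset ι := Finset.univ.filter (fun u => ∃ i, Sum.inl ⟨u, i⟩ ∈ s)
    let Y : Finset ι := Finset.univ.filter (fun u => ∃ i, Sum.inr ⟨u, i⟩ ∈ s)
    have hs : s.card ≤ ∑ v ∈ X, (M - f v) + ∑ v ∈ Y, f v := by
      have : s ⊆ Finset.disjSum (X.sigma (fun u => (Finset.univ : Finset (Fin (M - f u)))))
          (Y.sigma (fun u => (Finset.univ : Finset (Fin (f u))))) := by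
        rintro (⟨u, i⟩ | ⟨u, i⟩) h
        · simp only [Finset.inl_mem_disjSum, Finset.mem_sigma, Finset.mem_univ, and_true]
          simp only [X, Finset.mem_filter, Finset.mem_univ, true_and]
          exact ⟨i, h⟩
        · simp only [Finset.inr_mem_disjSum, Finset.mem_sigma, Finset.mem_univ, and_true]
          simp only [Y, Finset.mem_filter, Finset.mem_univ, true_and]
          exact ⟨i, h⟩
      have := Finset.card_le_card this
      simpa [Finset.card_disjSum, Finset.card_sigma] using this
    have hb : X ×ˢ Finset.univ ∪ Xᶜ ×ˢ Y ⊆ s.biUnion nb := by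
      intro ⟨u, w⟩ h
      simp only [Finset.mem_union, Finset.mem_product, Finset.mem_univ, and_true] at h
      simp only [Finset.mem_biUnion]
      rcases h with h | ⟨_, h⟩
      · simp only [X, Finset.mem_filter, Finset.mem_univ, true_and] at h
        obtain ⟨i, hi⟩ := h
        exact ⟨_, hi, by simp [nb]⟩
      · simp only [Y, Finset.mem_filter, Finset.mem_univ, true_and] at h
        obtain ⟨i, hi⟩ := h
        exact ⟨_, hi, by simp [nb]⟩
    have hb' := Finset.card_le_card hb
    rw [Finset.card_union_of_disjoint, Finset.card_product, Finset.card_product,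
      Finset.card_compl, Finset.card_univ] at hb'
    · have hc := gr_cut d f h1 h2 hM X Y
      have : ∑ v ∈ X, (M - f v) + ∑ v ∈ X, f v = X.card * M := by
        rw [← Finset.sum_add_distrib, Finset.sum_congr rfl (fun v _ => Nat.sub_add_cancel (hfM v))]
        simp
      rw [mul_comm (_ - _)] at hb'
      simp only [← hMdef] at hb' hc
      omega
    · rw [Finset.disjoint_left]
      rintro ⟨u, w⟩ ha hb
      simp at ha hb
      exact hb.1 ha
  obtain ⟨g, ginj, hg⟩ := (Finset.all_card_le_biUnion_card_iff_exists_injective nb).1 hall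
  have gbij : Function.Bijective g := (Fintype.bijective_iff_injective_and_card g).2 ⟨ginj, cardL⟩
  have gl : ∀ p, (g (Sum.inl p)).1 = p.1 := fun p => by
    have := hg (Sum.inl p); simpa [nb] using this
  have gr : ∀ p, (g (Sum.inr p)).2 = p.1 := fun p => by
    have := hg (Sum.inr p); simpa [nb] using this
  obtain ⟨R, hR⟩ : ∃ R : ι → ι → Prop, ∀ u w, R u w ↔ ∃ p, g (Sum.inr p) = (u, w) :=
    ⟨fun u w => ∃ p, g (Sum.inr p) = (u, w), fun _ _ => Iff.rfl⟩
  have nR : ∀ u w, ¬ R u w ↔ ∃ p, g (Sum.inl p) = (u, w) := by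
    intro u w
    rw [hR]
    constructor
    · intro h
      obtain ⟨x, hx⟩ := gbij.2 (u, w)
      rcases x with p | p
      · exact ⟨p, hx⟩
      · exact absurd ⟨p, hx⟩ h
    · rintro ⟨p, hp⟩ ⟨q, hq⟩
      have := ginj (hp.trans hq.symm)
      simp at this
  refine ⟨R, ?_, ?_⟩
  · intro u
    have h := Finset.card_filter_add_card_filter_not (s := (Finset.univ : Finset ι)) (fun w => R u w)
    have : (Finset.univ.filter (fun w => ¬ R u w)).card = M - f u := by
      have : Finset.univ.filter (fun w => ¬ R u w) =
          (Finset.univ : Finset (Fin (M - f u))).image (fun i => (g (Sum.inl ⟨u, i⟩)).2) := by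
        ext w
        simp only [Finset.mem_filter, Finset.mem_univ, true_and, nR, Finset.mem_image]
        constructor
        · rintro ⟨⟨u', i⟩, hp⟩
          have := gl ⟨u', i⟩
          rw [hp] at this
          simp only at this
          subst this
          exact ⟨i, by rw [hp]⟩
        · rintro ⟨i, hi⟩
          exact ⟨⟨u, i⟩, Prod.ext (gl _) hi⟩
      rw [this, Finset.card_image_of_injective]
      · simp
      · intro i j hij
        have := ginj (Prod.ext ((gl ⟨u, i⟩).trans (gl ⟨u, j⟩).symm) hij)
        simpa using this
    have := hfM u
    rw [Finset.card_univ] at h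
    omega
  · intro w
    have : Finset.univ.filter (fun u => R u w) =
        (Finset.univ : Finset (Fin (f w))).image (fun i => (g (Sum.inr ⟨w, i⟩)).1) := by
      ext u
      simp only [Finset.mem_filter, Finset.mem_univ, true_and, Finset.mem_image, hR]
      constructor
      · rintro ⟨⟨u', i⟩, hp⟩
        have := gr ⟨u', i⟩
        rw [hp] at this
        simp only at this
        subst this
        exact ⟨i, by rw [hp]⟩
      · rintro ⟨i, hi⟩
        exact ⟨⟨w, i⟩, Prod.ext hi (gr _)⟩
    rw [this, Finset.card_image_of_injective]
    · simp
    · intro i j hij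
      have := ginj (Prod.ext hij ((gr ⟨w, i⟩).trans (gr ⟨w, j⟩).symm))
      simpa using this

variable {V C : Type}

def Mv (G : SimpleGraph V) (S : Finset V) (K : Finset C) (c : V → C) (a b : C) : Prop :=
  b ∈ K ∧ ∃ x ∈ S, c x = a ∧ ∀ w ∈ S, c w = b → ¬ G.Adj x w

structure Good (G : SimpleGraph V) (S : Finset V) (K : Finset C) (s : ℕ) (c : V → C) : Prop where
  mem : ∀ v ∈ S, c v ∈ K
  proper : ∀ u ∈ S, ∀ v ∈ S, G.Adj u v → c u ≠ c v
  card : ∀ a ∈ K, (S.filter (fun v => c v = a)).card = s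

structure Near (G : SimpleGraph V) (S : Finset V) (K : Finset C) (s : ℕ) (c : V → C)
    (p p' : C) : Prop where
  mem : ∀ v ∈ S, c v ∈ K
  proper : ∀ u ∈ S, ∀ v ∈ S, G.Adj u v → c u ≠ c v
  hp : p ∈ K
  hp' : p' ∈ K
  card : ∀ a ∈ K, (S.filter (fun v => c v = a)).card + (if a = p then 1 else 0) =
    s + (if a = p' then 1 else 0)

lemma card_move (S : Finset V) (c : V → C) (x : V) (hx : x ∈ S) (a b : C) (hc : c x = a)
    (hab : b ≠ a) (e : C) :
    (S.filter (fun v => Function.update c x b v = e)).card + (if e = a then 1 else 0) =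
      (S.filter (fun v => c v = e)).card + (if e = b then 1 else 0) := by
  by_cases h1 : e = a
  · have : S.filter (fun v => c v = e) = insert x (S.filter (fun v => Function.update c x b v = e)) := by
      ext v
      by_cases hv : v = x
      · subst hv; simp [hx, hc, h1]
      · simp [hv]
    rw [this, Finset.card_insert_of_notMem]
    · subst h1; simp [hab.symm]
    · subst h1; simp [hab]
  · by_cases h2 : e = b
    · have : S.filter (fun v => Function.update c x b v = e) = insert x (S.filter (fun v => c v = e)) := by
        ext v
        by_cases hv : v = x
        · subst hv; simp [hx, h2]
        · simp [hv]
      rw [this, Finset.card_insert_of_notMem]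
      · subst h2; simp [hab]
      · subst h2; simp [hc, hab.symm]
    · have : S.filter (fun v => Function.update c x b v = e) = S.filter (fun v => c v = e) := by
        ext v
        by_cases hv : v = x
        · subst hv; simp [hc, Ne.symm h1, Ne.symm h2]
        · simp [hv]
      rw [this]; simp [h1, h2]

lemma near_move {G : SimpleGraph V} {S : Finset V} {K : Finset C} {s : ℕ} {c : V → C} {p a b : C}
    (h : Near G S K s c p a) (x : V) (hx : x ∈ S) (hc : c x = a) (hab : b ≠ a) (hb : b ∈ K)
    (hn : ∀ w ∈ S, c w = b → ¬ G.Adj x w) : Near G S K s (Function.update c x b) p b := by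
  refine ⟨?_, ?_, h.hp, hb, ?_⟩
  · intro v hv
    by_cases hvx : v = x
    · subst hvx; simpa using hb
    · simpa [hvx] using h.mem v hv
  · intro u hu v hv huv
    by_cases hux : u = x
    · subst hux
      have : v ≠ u := huv.ne'
      simp only [Function.update_self, Function.update_of_ne this]
      intro e
      exact hn v hv e.symm huv
    · by_cases hvx : v = x
      · subst hvx
        simp only [Function.update_self, Function.update_of_ne hux]
        intro e
        exact hn u hu e huv.symm
      · simpa [hux, hvx] using h.proper u hu v hv huv
  · intro e he
    have h1 := card_move S c x hx a b hc hab e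
    have h2 := h.card e he
    omega

lemma shift {G : SimpleGraph V} {S : Finset V} {K : Finset C} {s : ℕ} {p : C} :
    ∀ (l : List C) (c : V → C) (p' : C), Near G S K s c p p' →
      List.IsChain (Mv G S K c) (p' :: l) → (p' :: l).Nodup →
      (p' :: l).getLast (by simp) = p → ∃ c', Good G S K s c' := by
  intro l
  induction l with
  | nil =>
    intro c p' h _ _ hl
    simp at hl
    subst hl
    exact ⟨c, h.mem, h.proper, fun a ha => by have := h.card a ha; omega⟩
  | cons b l ih =>
    intro c p' h hch hnd hl
    rw [List.isChain_cons_cons] at hch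
    obtain ⟨⟨hb, x, hx, hcx, hn⟩, hch⟩ := hch
    have hbp : b ≠ p' := by rintro rfl; simp at hnd
    have hN := near_move h x hx hcx hbp hb hn
    refine ih _ b hN ?_ hnd.of_cons (by simpa using hl)
    have hp'l : p' ∉ b :: l := (List.nodup_cons.1 hnd).1
    have hbl : b ∉ l := (List.nodup_cons.1 hnd.of_cons).1
    have key : ∀ (l' : List C) (a : C), a ≠ p' → (∀ e ∈ l', e ≠ p' ∧ e ≠ b) →
        List.IsChain (Mv G S K c) (a :: l') →
        List.IsChain (Mv G S K (Function.update c x b)) (a :: l') := by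
      intro l'
      induction l' with
      | nil => intros; simp
      | cons f l' ih' =>
        intro a ha hall hc
        rw [List.isChain_cons_cons] at hc ⊢
        have hf := hall f (by simp)
        refine ⟨?_, ih' f hf.1 (fun e he => hall e (by simp [he])) hc.2⟩
        obtain ⟨⟨hfK, y, hy, hcy, hyn⟩, _⟩ := hc
        have hyx : y ≠ x := by rintro rfl; exact ha (hcy.symm.trans hcx)
        refine ⟨hfK, y, hy, by simp [hyx, hcy], ?_⟩
        intro w hw hcw
        have hwx : w ≠ x := by
          rintro rfl
          simp at hcw
          exact hf.2 hcw.symm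
        rw [Function.update_of_ne hwx] at hcw
        exact hyn w hw hcw
    exact key l b hbp (fun e he => ⟨by rintro rfl; exact hp'l (by simp [he]),
      by rintro rfl; exact hbl he⟩) hch

lemma exists_path {r : C → C → Prop} {a p : C} (h : Relation.ReflTransGen r a p) :
    ∃ l : List C, List.IsChain r (a :: l) ∧ (a :: l).Nodup ∧ (a :: l).getLast (by simp) = p := by
  induction h using Relation.ReflTransGen.head_induction_on with
  | refl => exact ⟨[], by simp⟩
  | head hab hbp ih =>
    rename_i a b
    obtain ⟨l, h1, h2, h3⟩ := ih
    by_cases ha : a ∈ b :: l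
    · obtain ⟨l1, l2, hl⟩ := List.append_of_mem ha
      refine ⟨l2, ?_, ?_, ?_⟩
      · rw [hl] at h1
        exact h1.right_of_append
      · rw [hl] at h2
        exact h2.of_append_right
      · simp only [hl] at h3
        rw [← h3]
        simp
    · exact ⟨b :: l, by simp [List.isChain_cons_cons, hab, h1], List.nodup_cons.2 ⟨ha, h2⟩, by simpa using h3⟩

/-- reach `p` with all step targets different from `U`. -/
def Rc (r : C → C → Prop) (p U a : C) : Prop :=
  Relation.ReflTransGen (fun x y => r x y ∧ y ≠ U) a p

lemma Rc.acc {r : C → C → Prop} {p U a : C} (h : Rc r p U a) : Relation.ReflTransGen r a p :=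
  Relation.ReflTransGen.mono (fun _ _ h => h.1) _ _ h

lemma rc_self {r : C → C → Prop} {p U : C} (h : Relation.ReflTransGen r U p) : Rc r p U U := by
  have : ∀ a, Relation.ReflTransGen r a p → Rc r p U a ∨ Rc r p U U := by
    intro a ha
    induction ha using Relation.ReflTransGen.head_induction_on with
    | refl => exact Or.inl .refl
    | head hab hbp ih =>
      rename_i a b
      rcases ih with ih | ih
      · by_cases hb : b = U
        · subst hb; exact Or.inr ih
        · exact Or.inl (.head ⟨hab, hb⟩ ih)
      · exact Or.inr ih
  rcases this U h with h | h <;> exact h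

lemma rc_transfer {r : C → C → Prop} {p U W a : C} (hW : ¬ Rc r p U W) (h : Rc r p U a) :
    Rc r p W a := by
  unfold Rc at h
  induction h using Relation.ReflTransGen.head_induction_on with
  | refl => exact .refl
  | head hab hbp ih =>
    rename_i a b
    refine .head ⟨hab.1, ?_⟩ ih
    rintro rfl
    exact hW hbp

/-- selection of the terminal family. -/
lemma exists_terminal {r : C → C → Prop} {p : C} (A : Finset C)
    (hA : ∀ a ∈ A, Relation.ReflTransGen r a p) (hp : p ∈ A) (hne : ∃ a ∈ A, a ≠ p) :
    ∃ U ∈ A, ∃ T ⊆ A, T.Nonempty ∧ p ∉ T ∧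
      (∀ a ∈ T, ∀ b ∈ A, b ≠ U → b ∉ T → ¬ r a b) ∧
      (∀ W ∈ T, ∀ a ∈ A, Rc r p W a) := by
  let T : C → Finset C := fun U => A.filter (fun a => ¬ Rc r p U a)
  have h0 : (A.filter (fun U => (T U).Nonempty)).Nonempty := by
    obtain ⟨a, ha, hap⟩ := hne
    refine ⟨p, Finset.mem_filter.2 ⟨hp, a, Finset.mem_filter.2 ⟨ha, ?_⟩⟩⟩
    intro h
    rcases Relation.ReflTransGen.cases_tail h with h | ⟨b, _, h⟩
    · exact hap h.symm
    · exact h.2 rfl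
  obtain ⟨U, hU, hmin⟩ := Finset.exists_min_image _ (fun U => (T U).card) h0
  rw [Finset.mem_filter] at hU
  refine ⟨U, hU.1, T U, Finset.filter_subset _ _, hU.2, ?_, ?_, ?_⟩
  · intro h
    exact (Finset.mem_filter.1 h).2 .refl
  · intro a ha b hb hbU hbT hab
    have h1 := (Finset.mem_filter.1 ha).2
    have h2 : Rc r p U b := by
      by_contra h
      exact hbT (Finset.mem_filter.2 ⟨hb, h⟩)
    exact h1 (.head ⟨hab, hbU⟩ h2)
  · intro W hW a ha
    by_contra hcon
    rw [Finset.mem_filter] at hW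
    have hm := hmin W (Finset.mem_filter.2 ⟨hW.1, a, Finset.mem_filter.2 ⟨ha, hcon⟩⟩)
    have : T W ⊂ T U := by
      rw [Finset.ssubset_iff_of_subset]
      · exact ⟨W, Finset.mem_filter.2 hW, fun h => (Finset.mem_filter.1 h).2 (rc_self (hA W hW.1))⟩
      · intro x hx
        rw [Finset.mem_filter] at hx ⊢
        exact ⟨hx.1, fun h => hx.2 (rc_transfer hW.2 h)⟩
    exact absurd (Finset.card_lt_card this) (not_lt.2 hm)

lemma deg_split (G : SimpleGraph V) (S : Finset V) (c : V → C) (v : V) (F : Finset C)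
    (B : Finset V) (hB : B ⊆ S) (hBF : ∀ w ∈ B, c w ∉ F)
    (h : ∀ a ∈ F, ∃ w ∈ S, c w = a ∧ G.Adj v w) :
    (B.filter (G.Adj v)).card + F.card ≤ (S.filter (G.Adj v)).card := by
  have h1 : F.card ≤ (S.filter (fun w => G.Adj v w ∧ c w ∈ F)).card := by
    have : F ⊆ (S.filter (fun w => G.Adj v w ∧ c w ∈ F)).image c := by
      intro a ha
      obtain ⟨w, hw, hc, hadj⟩ := h a ha
      exact Finset.mem_image.2 ⟨w, by simp [hw, hadj, hc, ha], hc⟩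
    exact (Finset.card_le_card this).trans Finset.card_image_le
  have h2 : Disjoint (B.filter (G.Adj v)) (S.filter (fun w => G.Adj v w ∧ c w ∈ F)) := by
    rw [Finset.disjoint_left]
    intro w hw hw'
    simp at hw hw'
    exact hBF w hw.1 hw'.2.2
  have h3 : B.filter (G.Adj v) ∪ S.filter (fun w => G.Adj v w ∧ c w ∈ F) ⊆ S.filter (G.Adj v) := by
    intro w hw
    simp at hw ⊢
    rcases hw with hw | hw
    · exact ⟨hB hw.1, hw.2⟩
    · exact ⟨hw.1, hw.2.1⟩
  have := Finset.card_le_card h3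
  rw [Finset.card_union_of_disjoint h2] at this
  omega

def Solo (G : SimpleGraph V) (S : Finset V) (c : V → C) (y z : V) : Prop :=
  G.Adj y z ∧ ∀ w ∈ S, c w = c z → G.Adj y w → w = z

section ctx
variable {G : SimpleGraph V} {S : Finset V} {K : Finset C} {s : ℕ} {c : V → C} {p p' : C}
  {A : Finset C}

lemma B_card (hN : Near G S K s c p p') (_hAK : A ⊆ K) (hpA : p ∈ A) (hp'A : p' ∉ A) :
    (S.filter (fun v => c v ∉ A)).card = (K \ A).card * s + 1 := by
  rw [Finset.card_eq_sum_card_fiberwise (f := c) (t := K \ A)]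
  · have : ∀ a ∈ K \ A, ((S.filter (fun v => c v ∉ A)).filter (fun v => c v = a)).card =
        s + (if a = p' then 1 else 0) := by
      intro a ha
      rw [Finset.mem_sdiff] at ha
      have h := hN.card a ha.1
      have hap : a ≠ p := by rintro rfl; exact ha.2 hpA
      rw [if_neg hap] at h
      rw [← h, Finset.filter_filter]
      congr 1
      ext v
      simp only [Finset.mem_filter]
      constructor
      · rintro ⟨h1, _, h2⟩; exact ⟨h1, h2⟩
      · rintro ⟨h1, h2⟩; exact ⟨h1, by rw [h2]; exact ha.2, h2⟩
    rw [Finset.sum_congr rfl this, Finset.sum_add_distrib, Finset.sum_ite_eq']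
    simp [hN.hp', hp'A]
  · intro v hv
    simp at hv ⊢
    exact ⟨hN.mem v hv.1, hv.2⟩

lemma B_nbr (hN : Near G S K s c p p')
    (hA : ∀ a, a ∈ A ↔ a ∈ K ∧ Relation.ReflTransGen (Mv G S K c) a p)
    (y : V) (hy : y ∈ S) (hyA : c y ∉ A) : ∀ a ∈ A, ∃ w ∈ S, c w = a ∧ G.Adj y w := by
  intro a ha
  by_contra hcon
  push Not at hcon
  apply hyA
  rw [hA] at ha ⊢
  exact ⟨hN.mem y hy, .head ⟨ha.1, y, hy, rfl, hcon⟩ ha.2⟩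

lemma K_card (hAK : A ⊆ K) : K.card = A.card + (K \ A).card := by
  have := Finset.card_sdiff_add_card_eq_card hAK
  omega

lemma use_IH (hN : Near G S K s c p p')
    (hdeg : ∀ v ∈ S, (S.filter (G.Adj v)).card < K.card)
    (hA : ∀ a, a ∈ A ↔ a ∈ K ∧ Relation.ReflTransGen (Mv G S K c) a p) (hp'A : p' ∉ A)
    (IH : ∀ K' : Finset C, K'.card < K.card → ∀ S' : Finset V, S'.card = K'.card * s →
      (∀ v ∈ S', (S'.filter (G.Adj v)).card < K'.card) → ∃ c, Good G S' K' s c)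
    (y : V) (hy : y ∈ S) (hyA : c y ∉ A) :
    ∃ g, Good G ((S.filter (fun v => c v ∉ A)).erase y) (K \ A) s g := by
  have hpA : p ∈ A := (hA p).2 ⟨hN.hp, .refl⟩
  have hAK : A ⊆ K := fun a ha => ((hA a).1 ha).1
  have hK := K_card hAK
  have hpos : 0 < A.card := Finset.card_pos.2 ⟨p, hpA⟩
  apply IH
  · omega
  · rw [Finset.card_erase_of_mem (by simp [hy, hyA]), B_card hN hAK hpA hp'A]
    simp
  · intro v hv
    have hv' := Finset.mem_filter.1 (Finset.mem_of_mem_erase hv)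
    have h1 := deg_split G S c v A ((S.filter (fun v => c v ∉ A)).erase y)
      ((Finset.erase_subset _ _).trans (Finset.filter_subset _ _))
      (fun w hw => (Finset.mem_filter.1 (Finset.mem_of_mem_erase hw)).2)
      (B_nbr hN hA v hv'.1 hv'.2)
    have h2 := hdeg v hv'.1
    omega

lemma case_one (hN : Near G S K s c p p')
    (hdeg : ∀ v ∈ S, (S.filter (G.Adj v)).card < K.card)
    (hA : ∀ a, a ∈ A ↔ a ∈ K ∧ Relation.ReflTransGen (Mv G S K c) a p) (hp'A : p' ∉ A)
    (IH : ∀ K' : Finset C, K'.card < K.card → ∀ S' : Finset V, S'.card = K'.card * s →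
      (∀ v ∈ S', (S'.filter (G.Adj v)).card < K'.card) → ∃ c, Good G S' K' s c)
    (W : C) (hW : W ∈ A) (z : V) (hz : z ∈ S) (hzW : c z = W) (y : V) (hy : y ∈ S)
    (hyA : c y ∉ A) (hsolo : Solo G S c y z) (X : C) (hX : X ∈ A) (hXW : X ≠ W)
    (hzX : ∀ w ∈ S, c w = X → ¬ G.Adj z w) (hR : Rc (Mv G S K c) p W X) :
    ∃ c', Good G S K s c' := by
  have hpA : p ∈ A := (hA p).2 ⟨hN.hp, .refl⟩
  have hAK : A ⊆ K := fun a ha => ((hA a).1 ha).1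
  obtain ⟨g, hg⟩ := use_IH hN hdeg hA hp'A IH y hy hyA
  set S0 := S.filter (fun v => c v ∈ A) with hS0
  set S1 := insert y S0 with hS1
  set c0 := Function.update c y W with hc0
  set c1 := Function.update c0 z X with hc1
  have hyz : y ≠ z := hsolo.1.ne
  have hyS0 : y ∉ S0 := by simp [hS0, hyA]
  have hzS1 : z ∈ S1 := by simp [hS1, hS0, hz, hzW, hW]
  have c0z : c0 z = W := by simp [hc0, hyz.symm, hzW]
  have c1z : c1 z = X := by simp [hc1]
  have c1y : c1 y = W := by simp [hc1, hc0, hyz]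
  have c1o : ∀ v, v ≠ y → v ≠ z → c1 v = c v := by
    intro v h1 h2; simp [hc1, hc0, h1, h2]
  have S1S : ∀ v ∈ S1, v ∈ S := by
    intro v hv
    simp only [hS1, hS0, Finset.mem_insert, Finset.mem_filter] at hv
    rcases hv with rfl | hv
    · exact hy
    · exact hv.1
  have S1A : ∀ v ∈ S1, v ≠ y → c v ∈ A := by
    intro v hv hvy
    simp only [hS1, hS0, Finset.mem_insert, Finset.mem_filter] at hv
    rcases hv with rfl | hv
    · exact absurd rfl hvy
    · exact hv.2
  have hpr : ∀ u ∈ S1, ∀ v ∈ S1, u ≠ z → u ≠ y → G.Adj u v → c1 u ≠ c1 v := by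
    intro u hu v hv huz huy huv
    rw [c1o u huy huz]
    by_cases hvz : v = z
    · subst hvz
      rw [c1z]
      intro e
      exact hzX u (S1S u hu) e huv.symm
    · by_cases hvy : v = y
      · subst hvy
        rw [c1y]
        intro e
        exact huz (hsolo.2 u (S1S u hu) (e.trans hzW.symm) huv.symm)
      · rw [c1o v hvy hvz]
        exact hN.proper u (S1S u hu) v (S1S v hv) huv
  have hN1 : Near G S1 A s c1 p X := by
    refine ⟨?_, ?_, hpA, hX, ?_⟩
    · intro v hv
      by_cases hvz : v = z
      · subst hvz; rw [c1z]; exact hX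
      · by_cases hvy : v = y
        · subst hvy; rw [c1y]; exact hW
        · rw [c1o v hvy hvz]; exact S1A v hv hvy
    · intro u hu v hv huv
      by_cases hu' : u ≠ z ∧ u ≠ y
      · exact hpr u hu v hv hu'.1 hu'.2 huv
      · by_cases hv' : v ≠ z ∧ v ≠ y
        · exact (hpr v hv u hu hv'.1 hv'.2 huv.symm).symm
        · have huv' := huv.ne
          have : (u = z ∧ v = y) ∨ (u = y ∧ v = z) := by grind
          rcases this with ⟨rfl, rfl⟩ | ⟨rfl, rfl⟩
          · rw [c1z, c1y]; exact hXW
          · rw [c1z, c1y]; exact hXW.symm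
    · intro e he
      have h1 := card_move S1 c0 z hzS1 W X c0z hXW e
      rw [← hc1] at h1
      have h2 : (S1.filter (fun v => c0 v = e)).card =
          (S.filter (fun v => c v = e)).card + (if e = W then 1 else 0) := by
        have h3 : S0.filter (fun v => c0 v = e) = S.filter (fun v => c v = e) := by
          ext v
          simp only [Finset.mem_filter, hS0]
          constructor
          · rintro ⟨⟨h1, h2⟩, h3⟩
            have : v ≠ y := by rintro rfl; exact hyA h2
            rw [hc0, Function.update_of_ne this] at h3
            exact ⟨h1, h3⟩
          · rintro ⟨h1, h3⟩
            have h4 : c v ∈ A := by rw [h3]; exact he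
            have : v ≠ y := by rintro rfl; exact hyA h4
            exact ⟨⟨h1, h4⟩, by rw [hc0, Function.update_of_ne this]; exact h3⟩
        rw [hS1, Finset.filter_insert]
        by_cases heW : e = W
        · subst heW
          rw [if_pos (by simp [hc0]), Finset.card_insert_of_notMem (by simp [hyS0]), h3]
          simp
        · rw [if_neg (by simp [hc0, Ne.symm heW]), h3]
          simp [heW]
      have h4 := hN.card e (hAK he)
      have h5 : e ≠ p' := by rintro rfl; exact hp'A he
      rw [if_neg h5] at h4
      omega
  obtain ⟨l, hl1, hl2, hl3⟩ := exists_path hR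
  have hacc : ∀ (l : List C) (a : C), List.IsChain (fun x y => Mv G S K c x y ∧ y ≠ W) (a :: l) →
      (a :: l).getLast (by simp) = p → Relation.ReflTransGen (Mv G S K c) a p := by
    intro l
    induction l with
    | nil => intro a _ h; simp at h; subst h; exact .refl
    | cons b l ih =>
      intro a hc h
      rw [List.isChain_cons_cons] at hc
      exact .head hc.1.1 (ih b hc.2 (by simpa using h))
  have key : ∀ (l' : List C) (a : C), a ≠ W → (∀ e ∈ l', e ≠ X) →
      List.IsChain (fun x y => Mv G S K c x y ∧ y ≠ W) (a :: l') →
      (a :: l').getLast (by simp) = p →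
      List.IsChain (Mv G S1 A c1) (a :: l') := by
    intro l'
    induction l' with
    | nil => intros; simp
    | cons f l' ih' =>
      intro a ha hall hc hlast
      have hacca := hacc _ _ hc hlast
      rw [List.isChain_cons_cons] at hc ⊢
      have hf := hall f (by simp)
      have hlast' : (f :: l').getLast (by simp) = p := by simpa using hlast
      refine ⟨?_, ih' f hc.1.2 (fun e he => hall e (by simp [he])) hc.2 hlast'⟩
      obtain ⟨⟨⟨hfK, x, hx, hcx, hxn⟩, hfW⟩, hc2⟩ := hc
      have hfA : f ∈ A := (hA f).2 ⟨hfK, hacc _ _ hc2 hlast'⟩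
      have haA : a ∈ A := (hA a).2 ⟨hcx ▸ hN.mem x hx, hacca⟩
      have hxy : x ≠ y := by rintro rfl; exact hyA (hcx ▸ haA)
      have hxz : x ≠ z := by rintro rfl; exact ha (hcx.symm.trans hzW)
      refine ⟨hfA, x, ?_, (c1o x hxy hxz).trans hcx, ?_⟩
      · simp [hS1, hS0, hx, hcx, haA]
      · intro w hw hcw
        have hwz : w ≠ z := by rintro rfl; exact hf (hcw.symm.trans c1z)
        have hwy : w ≠ y := by rintro rfl; exact hfW (hcw.symm.trans c1y)
        rw [c1o w hwy hwz] at hcw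
        exact hxn w (S1S w hw) hcw
  have hXl : X ∉ l := (List.nodup_cons.1 hl2).1
  obtain ⟨c2, hc2⟩ := shift l c1 X hN1
    (key l X hXW (fun e he => by rintro rfl; exact hXl he) hl1 hl3) hl2 hl3
  have hsplit : ∀ v ∈ S, v ∉ (S.filter (fun v => c v ∉ A)).erase y → v ∈ S1 := by
    intro v hv h
    simp only [hS1, hS0, Finset.mem_insert, Finset.mem_filter, Finset.mem_erase] at h ⊢
    tauto
  have hsplit' : ∀ v ∈ S1, v ∉ (S.filter (fun v => c v ∉ A)).erase y := by
    intro v hv h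
    simp only [hS1, hS0, Finset.mem_insert, Finset.mem_filter, Finset.mem_erase] at h hv
    tauto
  set B1 := (S.filter (fun v => c v ∉ A)).erase y with hB1
  have B1S : B1 ⊆ S := (Finset.erase_subset _ _).trans (Finset.filter_subset _ _)
  refine ⟨fun v => if v ∈ B1 then g v else c2 v, ?_, ?_, ?_⟩
  · intro v hv
    by_cases h : v ∈ B1
    · simp only [h, if_true]; exact (Finset.mem_sdiff.1 (hg.mem v h)).1
    · simp only [h, if_false]; exact hAK (hc2.mem v (hsplit v hv h))
  · intro u hu v hv huv
    by_cases h : u ∈ B1 <;> by_cases h' : v ∈ B1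
    · simp only [h, h', if_true]; exact hg.proper u h v h' huv
    · simp only [h, h', if_true, if_false]
      intro e
      exact (Finset.mem_sdiff.1 (hg.mem u h)).2 (e ▸ hc2.mem v (hsplit v hv h'))
    · simp only [h, h', if_true, if_false]
      intro e
      exact (Finset.mem_sdiff.1 (hg.mem v h')).2 (e ▸ hc2.mem u (hsplit u hu h))
    · simp only [h, h', if_false]
      exact hc2.proper u (hsplit u hu h) v (hsplit v hv h') huv
  · intro a ha
    by_cases haA : a ∈ A
    · rw [← hc2.card a haA]
      congr 1
      ext v
      simp only [Finset.mem_filter]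
      constructor
      · rintro ⟨h1, h2⟩
        by_cases h : v ∈ B1
        · simp only [h, if_true] at h2
          exact absurd haA (h2 ▸ (Finset.mem_sdiff.1 (hg.mem v h)).2)
        · simp only [h, if_false] at h2
          exact ⟨hsplit v h1 h, h2⟩
      · rintro ⟨h1, h2⟩
        refine ⟨S1S v h1, ?_⟩
        rw [if_neg (hsplit' v h1)]; exact h2
    · rw [← hg.card a (Finset.mem_sdiff.2 ⟨ha, haA⟩)]
      congr 1
      ext v
      simp only [Finset.mem_filter]
      constructor
      · rintro ⟨h1, h2⟩
        by_cases h : v ∈ B1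
        · simp only [h, if_true] at h2
          exact ⟨h, h2⟩
        · simp only [h, if_false] at h2
          exact absurd (h2 ▸ hc2.mem v (hsplit v h1 h)) haA
      · rintro ⟨h1, h2⟩
        refine ⟨B1S h1, ?_⟩
        rw [if_pos h1]; exact h2

lemma case_two (hN : Near G S K s c p p')
    (hdeg : ∀ v ∈ S, (S.filter (G.Adj v)).card < K.card)
    (hA : ∀ a, a ∈ A ↔ a ∈ K ∧ Relation.ReflTransGen (Mv G S K c) a p) (hp'A : p' ∉ A)
    (IH : ∀ K' : Finset C, K'.card < K.card → ∀ S' : Finset V, S'.card = K'.card * s →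
      (∀ v ∈ S', (S'.filter (G.Adj v)).card < K'.card) → ∃ c, Good G S' K' s c)
    (W : C) (hW : W ∈ A) (hWp : W ≠ p) (hterm : ∀ a ∈ A, Rc (Mv G S K c) p W a)
    (z : V) (hz : z ∈ S) (hzW : c z = W)
    (hzn : ∀ X ∈ A, X ≠ W → ∃ w ∈ S, c w = X ∧ G.Adj z w)
    (y₁ y₂ : V) (hy₁ : y₁ ∈ S) (hy₂ : y₂ ∈ S) (hy₁A : c y₁ ∉ A) (hy₂A : c y₂ ∉ A)
    (hne : y₁ ≠ y₂) (hnadj : ¬ G.Adj y₁ y₂) (hs₁ : Solo G S c y₁ z) (hs₂ : Solo G S c y₂ z) :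
    ∃ c' X, Near G S K s c' p X ∧
      ∃ b ∈ K, b ∉ A ∧ Relation.ReflTransGen (Mv G S K c') b p ∧
        ∀ a ∈ A, Relation.ReflTransGen (Mv G S K c') a p := by
  have hpA : p ∈ A := (hA p).2 ⟨hN.hp, .refl⟩
  have hAK : A ⊆ K := fun a ha => ((hA a).1 ha).1
  have hK := K_card hAK
  obtain ⟨g, hg⟩ := use_IH hN hdeg hA hp'A IH y₁ hy₁ hy₁A
  set B := S.filter (fun v => c v ∉ A) with hB
  set B1 := B.erase y₁ with hB1
  have BS : B ⊆ S := Finset.filter_subset _ _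
  have B1S : B1 ⊆ S := (Finset.erase_subset _ _).trans BS
  have B1A : ∀ v ∈ B1, c v ∉ A := fun v hv => (Finset.mem_filter.1 (Finset.mem_of_mem_erase hv)).2
  have memB1 : ∀ v ∈ S, c v ∉ A → v ≠ y₁ → v ∈ B1 := fun v h1 h2 h3 =>
    Finset.mem_erase.2 ⟨h3, Finset.mem_filter.2 ⟨h1, h2⟩⟩
  have gA : ∀ v ∈ B1, g v ∉ A := fun v hv => (Finset.mem_sdiff.1 (hg.mem v hv)).2
  have hzA : c z ∈ A := hzW ▸ hW
  have hzB1 : z ∉ B1 := fun h => B1A z h hzA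
  have hy₁B1 : y₁ ∉ B1 := by simp [hB1]
  have hzy₁ : z ≠ y₁ := hs₁.1.ne'
  -- the colour for `z`
  have hzdeg : (B1.filter (G.Adj z)).card < (K \ A).card := by
    have h1 := deg_split G S c z (A.erase W) B BS
      (fun w hw h => (Finset.mem_filter.1 hw).2 (Finset.mem_of_mem_erase h))
      (fun a ha => hzn a (Finset.mem_of_mem_erase ha) (Finset.ne_of_mem_erase ha))
    have h2 := hdeg z hz
    rw [Finset.card_erase_of_mem hW] at h1
    have h3 : 0 < A.card := Finset.card_pos.2 ⟨p, hpA⟩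
    have h4 : (B1.filter (G.Adj z)).card < (B.filter (G.Adj z)).card := by
      apply Finset.card_lt_card
      rw [Finset.ssubset_iff_of_subset (Finset.filter_subset_filter _ (Finset.erase_subset _ _))]
      exact ⟨y₁, by simp [hB, hy₁, hy₁A, hs₁.1.symm], by simp [hy₁B1]⟩
    omega
  obtain ⟨X, hX, hXg⟩ : ∃ X ∈ K \ A, ∀ w ∈ B1, g w = X → ¬ G.Adj z w := by
    have : ((B1.filter (G.Adj z)).image g).card < (K \ A).card :=
      lt_of_le_of_lt Finset.card_image_le hzdeg
    obtain ⟨X, hX, hX'⟩ := Finset.exists_mem_notMem_of_card_lt_card this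
    refine ⟨X, hX, fun w hw e hadj => hX' (Finset.mem_image.2 ⟨w, by simp [hw, hadj], e⟩)⟩
  obtain ⟨hXK, hXA⟩ := Finset.mem_sdiff.1 hX
  have hXW : X ≠ W := by rintro rfl; exact hXA hW
  obtain ⟨c', hc'⟩ : ∃ c' : V → C, c' = fun v => if v ∈ B1 then g v else if v = z then X else
    if v = y₁ then W else c v := ⟨_, rfl⟩
  have cB : ∀ v ∈ B1, c' v = g v := fun v hv => by simp [hc', hv]
  have cz : c' z = X := by simp [hc', hzB1]
  have cy : c' y₁ = W := by simp [hc', hy₁B1, hzy₁.symm]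
  have co : ∀ v, v ∉ B1 → v ≠ z → v ≠ y₁ → c' v = c v := fun v h1 h2 h3 => by simp [hc', h1, h2, h3]
  have coA : ∀ v ∈ S, v ∉ B1 → v ≠ y₁ → c v ∈ A := by
    intro v hv h1 h2
    by_contra h
    exact h1 (memB1 v hv h h2)
  have cA : ∀ v ∈ S, c v ∈ A → v ≠ z → c' v = c v := by
    intro v hv h1 h2
    refine co v (fun h => B1A v h h1) h2 ?_
    rintro rfl; exact hy₁A h1
  -- preimages of colours in `A`
  have cinv : ∀ v ∈ S, c' v ∈ A → v = y₁ ∨ (v ≠ z ∧ c v = c' v) := by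
    intro v hv h
    by_cases h1 : v = y₁
    · exact Or.inl h1
    · right
      have h2 : v ∉ B1 := fun h2 => gA v h2 (cB v h2 ▸ h)
      have h3 : v ≠ z := by rintro rfl; exact hXA (cz ▸ h)
      exact ⟨h3, (co v h2 h3 h1).symm⟩
  have hpr : ∀ u ∈ S, ∀ v ∈ S, c' u = c' v → c' u ∈ A → G.Adj u v → False := by
    intro u hu v hv e hA' huv
    rcases cinv u hu hA' with rfl | ⟨h1, h2⟩
    · rcases cinv v hv (e ▸ hA') with rfl | ⟨h3, h4⟩
      · exact huv.ne rfl
      · exact h3 (hs₁.2 v hv (by rw [h4, ← e, cy, hzW]) huv)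
    · rcases cinv v hv (e ▸ hA') with rfl | ⟨h3, h4⟩
      · exact h1 (hs₁.2 u hu (by rw [h2, e, cy, hzW]) huv.symm)
      · exact hN.proper u hu v hv huv (by rw [h2, h4, e])
  have cinv' : ∀ v ∈ S, c' v ∉ A → v = z ∨ v ∈ B1 := by
    intro v hv h
    by_contra hcon
    push Not at hcon
    by_cases h1 : v = y₁
    · subst h1; exact h (cy ▸ hW)
    · exact h (co v hcon.2 hcon.1 h1 ▸ coA v hv hcon.2 h1)
  have hN' : Near G S K s c' p X := by
    refine ⟨?_, ?_, hN.hp, hXK, ?_⟩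
    · intro v hv
      by_cases h : c' v ∈ A
      · exact hAK h
      · rcases cinv' v hv h with rfl | h
        · rw [cz]; exact hXK
        · rw [cB v h]; exact (Finset.mem_sdiff.1 (hg.mem v h)).1
    · intro u hu v hv huv e
      by_cases h : c' u ∈ A
      · exact hpr u hu v hv e h huv
      · rcases cinv' u hu h with rfl | h1
        · rcases cinv' v hv (e ▸ h) with rfl | h2
          · exact huv.ne rfl
          · rw [cz, cB v h2] at e
            exact hXg v h2 e.symm huv
        · rcases cinv' v hv (e ▸ h) with rfl | h2
          · rw [cz, cB u h1] at e
            exact hXg u h1 e huv.symm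
          · rw [cB u h1, cB v h2] at e
            exact hg.proper u h1 v h2 huv e
    · intro a ha
      by_cases haA : a ∈ A
      · have haX : a ≠ X := by rintro rfl; exact hXA haA
        have hap' : a ≠ p' := by rintro rfl; exact hp'A haA
        have h0 := hN.card a ha
        rw [if_neg hap'] at h0
        rw [if_neg haX]
        by_cases haW : a = W
        · have : S.filter (fun v => c' v = a) = insert y₁ ((S.filter (fun v => c v = a)).erase z) := by
            ext v
            simp only [Finset.mem_filter, Finset.mem_insert, Finset.mem_erase]
            constructor
            · rintro ⟨h1, h2⟩
              rcases cinv v h1 (h2 ▸ haA) with h | ⟨h, h'⟩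
              · exact Or.inl h
              · exact Or.inr ⟨h, h1, h'.trans h2⟩
            · rintro (rfl | ⟨h1, h2, h3⟩)
              · exact ⟨hy₁, by rw [cy, haW]⟩
              · exact ⟨h2, by rw [cA v h2 (h3 ▸ haA) h1, h3]⟩
          have hmem : z ∈ S.filter (fun v => c v = a) := by simp [hz, hzW, haW]
          have hpos := Finset.card_pos.2 ⟨z, hmem⟩
          rw [this, Finset.card_insert_of_notMem, Finset.card_erase_of_mem hmem]
          · omega
          · simp only [Finset.mem_erase, Finset.mem_filter, not_and]
            intro _ _ h
            exact hy₁A (h ▸ haA)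
        · have : S.filter (fun v => c' v = a) = S.filter (fun v => c v = a) := by
            ext v
            simp only [Finset.mem_filter]
            constructor
            · rintro ⟨h1, h2⟩
              rcases cinv v h1 (h2 ▸ haA) with h | ⟨h, h'⟩
              · subst h; exact absurd (h2.symm.trans cy) haW
              · exact ⟨h1, h'.trans h2⟩
            · rintro ⟨h2, h3⟩
              have : v ≠ z := by rintro rfl; exact haW (h3.symm.trans hzW)
              exact ⟨h2, by rw [cA v h2 (h3 ▸ haA) this, h3]⟩
          rw [this]; exact h0
      · have hap : a ≠ p := by rintro rfl; exact haA hpA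
        have h0 := hg.card a (Finset.mem_sdiff.2 ⟨ha, haA⟩)
        rw [if_neg hap]
        by_cases haX : a = X
        · have : S.filter (fun v => c' v = a) = insert z (B1.filter (fun v => g v = a)) := by
            ext v
            simp only [Finset.mem_filter, Finset.mem_insert]
            constructor
            · rintro ⟨h1, h2⟩
              rcases cinv' v h1 (h2 ▸ haA) with h | h
              · exact Or.inl h
              · exact Or.inr ⟨h, (cB v h).symm.trans h2⟩
            · rintro (rfl | ⟨h1, h2⟩)
              · exact ⟨hz, by rw [cz, haX]⟩
              · exact ⟨B1S h1, (cB v h1).trans h2⟩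
          rw [this, Finset.card_insert_of_notMem (by simp [hzB1]), if_pos haX, h0]
        · have : S.filter (fun v => c' v = a) = B1.filter (fun v => g v = a) := by
            ext v
            simp only [Finset.mem_filter]
            constructor
            · rintro ⟨h1, h2⟩
              rcases cinv' v h1 (h2 ▸ haA) with h | h
              · subst h; exact absurd (h2.symm.trans cz) haX
              · exact ⟨h, (cB v h).symm.trans h2⟩
            · rintro ⟨h1, h2⟩
              exact ⟨B1S h1, (cB v h1).trans h2⟩
          rw [this, if_neg haX, h0]
  -- preserved moves
  have mvp : ∀ a b, a ∈ A → b ∈ A → b ≠ W → Mv G S K c a b → Mv G S K c' a b := by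
    rintro a b haA hbA hbW ⟨hbK, x, hx, hcx, hxn⟩
    have hxz : x ≠ z := by
      rintro rfl
      obtain ⟨w, hw, h1, h2⟩ := hzn b hbA hbW
      exact hxn w hw h1 h2
    refine ⟨hbK, x, hx, by rw [cA x hx (hcx ▸ haA) hxz, hcx], ?_⟩
    intro w hw hcw
    rcases cinv w hw (hcw ▸ hbA) with h | ⟨_, h⟩
    · subst h; exact absurd (hcw.symm.trans cy) hbW
    · exact hxn w hw (h.trans hcw)
  have acc' : ∀ a ∈ A, Relation.ReflTransGen (Mv G S K c') a p := by
    intro a ha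
    have h := hterm a ha
    unfold Rc at h
    induction h using Relation.ReflTransGen.head_induction_on with
    | refl => exact .refl
    | head hab hbp ih =>
      rename_i a b
      have hbA : b ∈ A := (hA b).2 ⟨hab.1.1, Rc.acc hbp⟩
      exact .head (mvp a b ha hbA hab.2 hab.1) (ih hbA)
  have hy₂B1 : y₂ ∈ B1 := memB1 y₂ hy₂ hy₂A hne.symm
  refine ⟨c', X, hN', g y₂, (Finset.mem_sdiff.1 (hg.mem y₂ hy₂B1)).1, gA y₂ hy₂B1, ?_, acc'⟩
  refine .head ⟨hAK hW, y₂, hy₂, cB y₂ hy₂B1, ?_⟩ (acc' W hW)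
  intro w hw hcw hadj
  rcases cinv w hw (hcw ▸ hW) with h | ⟨h, h'⟩
  · subst h; exact hnadj hadj.symm
  · exact h (hs₂.2 w hw (by rw [h', hcw, hzW]) hadj)

lemma deg_bip (G : SimpleGraph V) (B D : Finset V) (wt : V → ℕ) (m M : ℕ)
    (h1 : ∀ y ∈ B, m ≤ ∑ z ∈ D.filter (G.Adj y), wt z)
    (h2 : ∀ z ∈ D, wt z * (B.filter (G.Adj z)).card ≤ M) : B.card * m ≤ D.card * M := by
  calc B.card * m ≤ ∑ y ∈ B, ∑ z ∈ D.filter (G.Adj y), wt z := by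
        simpa using Finset.card_nsmul_le_sum B _ m h1
    _ = ∑ y ∈ B, ∑ z ∈ D, if G.Adj y z then wt z else 0 := by simp [Finset.sum_filter]
    _ = ∑ z ∈ D, ∑ y ∈ B, if G.Adj y z then wt z else 0 := Finset.sum_comm
    _ = ∑ z ∈ D, wt z * (B.filter (G.Adj z)).card := by
        refine Finset.sum_congr rfl fun z _ => ?_
        rw [← Finset.sum_filter, Finset.sum_const, smul_eq_mul, mul_comm]
        simp [G.adj_comm]
    _ ≤ D.card * M := by simpa using Finset.sum_le_card_nsmul D _ M h2

lemma not_single (hN : Near G S K s c p p')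
    (hdeg : ∀ v ∈ S, (S.filter (G.Adj v)).card < K.card)
    (hA : ∀ a, a ∈ A ↔ a ∈ K ∧ Relation.ReflTransGen (Mv G S K c) a p) (hp'A : p' ∉ A) :
    ∃ a ∈ A, a ≠ p := by
  by_contra hcon
  push Not at hcon
  have hpA : p ∈ A := (hA p).2 ⟨hN.hp, .refl⟩
  have hAK : A ⊆ K := fun a ha => ((hA a).1 ha).1
  have hK := K_card hAK
  have hA1 : A = {p} := by
    ext a; simp only [Finset.mem_singleton]
    exact ⟨hcon a, fun h => h ▸ hpA⟩
  have hAc : A.card = 1 := by rw [hA1]; simp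
  have hBc := B_card hN hAK hpA hp'A
  have hpp : p ≠ p' := by rintro rfl; exact hp'A hpA
  have hpc := hN.card p hN.hp
  rw [if_pos rfl, if_neg hpp] at hpc
  have := deg_bip G (S.filter (fun v => c v ∉ A)) (S.filter (fun v => c v = p)) (fun _ => 1) 1
    (K \ A).card ?_ ?_
  · rw [hBc] at this
    nlinarith
  · intro y hy
    rw [Finset.mem_filter] at hy
    obtain ⟨w, hw, h1, h2⟩ := B_nbr hN hA y hy.1 hy.2 p hpA
    simp only [Finset.sum_const, smul_eq_mul, mul_one]
    exact Finset.card_pos.2 ⟨w, by simp [hw, h1, h2]⟩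
  · intro z hz
    rw [Finset.mem_filter] at hz
    have h1 := hdeg z hz.1
    have h2 := Finset.card_le_card (Finset.filter_subset_filter (G.Adj z)
      (Finset.filter_subset (fun v => c v ∉ A) S))
    omega

lemma solo_count (hN : Near G S K s c p p')
    (hdeg : ∀ v ∈ S, (S.filter (G.Adj v)).card < K.card)
    (hA : ∀ a, a ∈ A ↔ a ∈ K ∧ Relation.ReflTransGen (Mv G S K c) a p)
    (T : Finset C) (hTA : T ⊆ A) (y : V) (hy : y ∈ S) (hyA : c y ∉ A) :
    T.card + 1 + ((S.filter (fun v => c v ∉ A)).filter (G.Adj y)).card ≤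
      (S.filter (fun z => c z ∈ T ∧ Solo G S c y z)).card + (K \ A).card := by
  have hAK : A ⊆ K := fun a ha => ((hA a).1 ha).1
  have hK := K_card hAK
  have hd := hdeg y hy
  have hnb := B_nbr hN hA y hy hyA
  set D : C → ℕ := fun a => (S.filter (fun v => G.Adj y v ∧ c v = a)).card with hD
  set Y : C → ℕ := fun a => (S.filter (fun z => Solo G S c y z ∧ c z = a)).card with hY
  have e1 : (S.filter (G.Adj y)).card = ((S.filter (fun v => c v ∉ A)).filter (G.Adj y)).card +
      ∑ a ∈ A, D a := by
    rw [← Finset.card_filter_add_card_filter_not (s := S.filter (G.Adj y)) (fun v => c v ∈ A),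
      add_comm]
    congr 1
    · congr 1; ext v; simp only [Finset.mem_filter]; tauto
    · rw [Finset.card_eq_sum_card_fiberwise (f := c) (t := A)]
      · refine Finset.sum_congr rfl fun a ha => ?_
        simp only [hD]
        congr 1; ext v; simp only [Finset.mem_filter]
        constructor
        · tauto
        · rintro ⟨h1, h2, h3⟩
          exact ⟨⟨⟨h1, h2⟩, h3 ▸ ha⟩, h3⟩
      · intro v hv
        simp at hv ⊢
        exact hv.2
  have e2 : (S.filter (fun z => c z ∈ T ∧ Solo G S c y z)).card = ∑ a ∈ T, Y a := by
    rw [Finset.card_eq_sum_card_fiberwise (f := c) (t := T)]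
    · refine Finset.sum_congr rfl fun a ha => ?_
      simp only [hY]
      congr 1; ext v; simp only [Finset.mem_filter]
      constructor
      · tauto
      · rintro ⟨h1, h2, h3⟩
        exact ⟨⟨h1, h3 ▸ ha, h2⟩, h3⟩
    · intro v hv
      simp at hv ⊢
      exact hv.2.1
  have e3 : ∑ a ∈ A \ T, D a + ∑ a ∈ T, D a = ∑ a ∈ A, D a := Finset.sum_sdiff hTA
  have D1 : ∀ a ∈ A, 1 ≤ D a := by
    intro a ha
    obtain ⟨w, hw, h1, h2⟩ := hnb a ha
    exact Finset.card_pos.2 ⟨w, by simp [hw, h1, h2]⟩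
  have l1 : (A \ T).card ≤ ∑ a ∈ A \ T, D a := by
    simpa using Finset.card_nsmul_le_sum (A \ T) D 1 (fun a ha => D1 a (Finset.mem_sdiff.1 ha).1)
  have l2 : T.card * 2 ≤ ∑ a ∈ T, D a + ∑ a ∈ T, Y a := by
    rw [← Finset.sum_add_distrib]
    have := Finset.card_nsmul_le_sum T (fun a => D a + Y a) 2 ?_
    · simpa using this
    · intro a ha
      have h1 := D1 a (hTA ha)
      by_cases h2 : D a = 1
      · have : 1 ≤ Y a := by
          obtain ⟨z, hz⟩ := Finset.card_eq_one.1 h2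
          have hz' : z ∈ S.filter (fun v => G.Adj y v ∧ c v = a) := by rw [hz]; simp
          rw [Finset.mem_filter] at hz'
          refine Finset.card_pos.2 ⟨z, ?_⟩
          rw [Finset.mem_filter]
          refine ⟨hz'.1, ⟨hz'.2.1, ?_⟩, hz'.2.2⟩
          intro w hw h3 h4
          have : w ∈ S.filter (fun v => G.Adj y v ∧ c v = a) := by
            simp [hw, h4, h3, hz'.2.2]
          rw [hz] at this
          simpa using this
        omega
      · omega
  have l3 := Finset.card_sdiff_add_card_eq_card hTA
  omega

lemma t_ge_q (hN : Near G S K s c p p')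
    (hdeg : ∀ v ∈ S, (S.filter (G.Adj v)).card < K.card)
    (hA : ∀ a, a ∈ A ↔ a ∈ K ∧ Relation.ReflTransGen (Mv G S K c) a p) (hp'A : p' ∉ A)
    (U : C) (T : Finset C) (hTA : T ⊆ A) (hpT : p ∉ T)
    (hT : ∀ a ∈ T, ∀ b ∈ A, b ≠ U → b ∉ T → ¬ Mv G S K c a b)
    (W : C) (hW : W ∈ T)
    (hno : ∀ z ∈ S, c z = W → ∀ y ∈ S, c y ∉ A → Solo G S c y z → ∀ X ∈ A, X ≠ W →
      ∃ w ∈ S, c w = X ∧ G.Adj z w) :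
    (K \ A).card ≤ T.card := by
  by_contra hcon
  push Not at hcon
  have hpA : p ∈ A := (hA p).2 ⟨hN.hp, .refl⟩
  have hAK : A ⊆ K := fun a ha => ((hA a).1 ha).1
  have hK := K_card hAK
  have hBc := B_card hN hAK hpA hp'A
  have hApos : 0 < A.card := Finset.card_pos.2 ⟨p, hpA⟩
  have hWc := hN.card W (hAK (hTA hW))
  rw [if_neg (by rintro rfl; exact hpT hW), if_neg (by rintro rfl; exact hp'A (hTA hW))] at hWc
  have := deg_bip G (S.filter (fun v => c v ∉ A)) (S.filter (fun v => c v = W))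
    (fun z => if ∃ y ∈ S, c y ∉ A ∧ Solo G S c y z then 2 else 1) 2 (2 * (K \ A).card) ?_ ?_
  · rw [hBc] at this
    simp only [add_zero] at hWc
    rw [hWc] at this
    nlinarith
  · intro y hy
    rw [Finset.mem_filter] at hy
    obtain ⟨z, hz, h1, h2⟩ := B_nbr hN hA y hy.1 hy.2 W (hTA hW)
    have hzm : z ∈ (S.filter (fun v => c v = W)).filter (G.Adj y) := by simp [hz, h1, h2]
    by_cases hs : Solo G S c y z
    · refine le_trans ?_ (Finset.single_le_sum (fun _ _ => Nat.zero_le _) hzm)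
      rw [if_pos ⟨y, hy.1, hy.2, hs⟩]
    · have : ∃ w ∈ S, c w = c z ∧ G.Adj y w ∧ w ≠ z := by
        by_contra hcon
        push Not at hcon
        exact hs ⟨h2, hcon⟩
      obtain ⟨w, hw, h3, h4, h5⟩ := this
      have hwm : w ∈ (S.filter (fun v => c v = W)).filter (G.Adj y) := by simp [hw, h3, h1, h4]
      calc 2 ≤ ((S.filter (fun v => c v = W)).filter (G.Adj y)).card :=
            Finset.one_lt_card.2 ⟨w, hwm, z, hzm, h5⟩
        _ = ∑ z ∈ (S.filter (fun v => c v = W)).filter (G.Adj y), 1 := by simp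
        _ ≤ _ := Finset.sum_le_sum (fun z _ => by split_ifs <;> omega)
  · intro z hz
    rw [Finset.mem_filter] at hz
    have hd := hdeg z hz.1
    split_ifs with h
    · obtain ⟨y, hy, hyA, hs⟩ := h
      have h1 := deg_split G S c z (A.erase W) (S.filter (fun v => c v ∉ A)) (Finset.filter_subset _ _)
        (fun w hw h => (Finset.mem_filter.1 hw).2 (Finset.mem_of_mem_erase h))
        (fun a ha => hno z hz.1 hz.2 y hy hyA hs a (Finset.mem_of_mem_erase ha)
          (Finset.ne_of_mem_erase ha))
      rw [Finset.card_erase_of_mem (hTA hW)] at h1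
      omega
    · have h1 := deg_split G S c z (A \ insert U T) (S.filter (fun v => c v ∉ A))
        (Finset.filter_subset _ _)
        (fun w hw h => (Finset.mem_filter.1 hw).2 (Finset.mem_sdiff.1 h).1) ?_
      · have h2 := Finset.le_card_sdiff (insert U T) A
        have h3 := Finset.card_insert_le U T
        omega
      · intro b hb
        simp only [Finset.mem_sdiff, Finset.mem_insert, not_or] at hb
        by_contra hcon
        push Not at hcon
        exact hT W hW b hb.1 hb.2.1 hb.2.2 ⟨hAK hb.1, z, hz.1, hz.2, hcon⟩

lemma exists_pair (hN : Near G S K s c p p')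
    (hdeg : ∀ v ∈ S, (S.filter (G.Adj v)).card < K.card)
    (hA : ∀ a, a ∈ A ↔ a ∈ K ∧ Relation.ReflTransGen (Mv G S K c) a p) (hp'A : p' ∉ A)
    (T : Finset C) (hTA : T ⊆ A) (hpT : p ∉ T) (hq : (K \ A).card ≤ T.card) :
    ∃ z ∈ S, c z ∈ T ∧ ∃ y₁ ∈ S, ∃ y₂ ∈ S, c y₁ ∉ A ∧ c y₂ ∉ A ∧ y₁ ≠ y₂ ∧ ¬ G.Adj y₁ y₂ ∧
      Solo G S c y₁ z ∧ Solo G S c y₂ z := by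
  have hpA : p ∈ A := (hA p).2 ⟨hN.hp, .refl⟩
  have hAK : A ⊆ K := fun a ha => ((hA a).1 ha).1
  have hK := K_card hAK
  have hBc := B_card hN hAK hpA hp'A
  set B := S.filter (fun v => c v ∉ A) with hB
  have hBm : ∀ v ∈ B, v ∈ S ∧ c v ∉ A := fun v hv => Finset.mem_filter.1 hv
  let P := B.powerset.filter (fun I => ∀ u ∈ I, ∀ v ∈ I, ¬ G.Adj u v)
  obtain ⟨I, hI, hmax⟩ := Finset.exists_max_image P Finset.card ⟨∅, by simp [P]⟩
  simp only [P, Finset.mem_filter, Finset.mem_powerset] at hI hmax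
  obtain ⟨hIB, hInd⟩ := hI
  have hdom : ∀ v ∈ B, v ∈ I ∨ ∃ y ∈ I, G.Adj y v := by
    intro v hv
    by_contra hcon
    push Not at hcon
    have := hmax (insert v I) ⟨Finset.insert_subset hv hIB, ?_⟩
    · rw [Finset.card_insert_of_notMem hcon.1] at this
      omega
    · intro a ha b hb
      rw [Finset.mem_insert] at ha hb
      rcases ha with rfl | ha <;> rcases hb with rfl | hb
      · exact G.irrefl
      · exact fun h => hcon.2 b hb h.symm
      · exact hcon.2 a ha
      · exact hInd a ha b hb
  have hcov : B.card ≤ ∑ y ∈ I, ((B.filter (G.Adj y)).card + 1) := by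
    have : B ⊆ I.biUnion (fun y => insert y (B.filter (G.Adj y))) := by
      intro v hv
      rw [Finset.mem_biUnion]
      rcases hdom v hv with h | ⟨y, hy, h⟩
      · exact ⟨v, h, by simp⟩
      · exact ⟨y, hy, by simp [hv, h]⟩
    refine (Finset.card_le_card this).trans (Finset.card_biUnion_le.trans ?_)
    exact Finset.sum_le_sum (fun y _ => Finset.card_insert_le _ _)
  by_contra hcon
  push Not at hcon
  let Sy : V → Finset V := fun y => S.filter (fun z => c z ∈ T ∧ Solo G S c y z)
  have hdisj : ∀ y₁ ∈ I, ∀ y₂ ∈ I, y₁ ≠ y₂ → Disjoint (Sy y₁) (Sy y₂) := by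
    intro y₁ h1 y₂ h2 hne
    rw [Finset.disjoint_left]
    intro z hz1 hz2
    simp only [Sy, Finset.mem_filter] at hz1 hz2
    exact hcon z hz1.1 hz1.2.1 y₁ (hBm _ (hIB h1)).1 y₂ (hBm _ (hIB h2)).1 (hBm _ (hIB h1)).2
      (hBm _ (hIB h2)).2 hne (hInd y₁ h1 y₂ h2) hz1.2.2 hz2.2.2
  have hTc : (S.filter (fun z => c z ∈ T)).card = T.card * s := by
    rw [Finset.card_eq_sum_card_fiberwise (f := c) (t := T)]
    · rw [Finset.sum_const_nat]
      intro a ha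
      have h := hN.card a (hAK (hTA ha))
      rw [if_neg (by rintro rfl; exact hpT ha), if_neg (by rintro rfl; exact hp'A (hTA ha))] at h
      simp only [add_zero] at h
      rw [← h]
      congr 1; ext v; simp only [Finset.mem_filter]
      constructor
      · tauto
      · rintro ⟨h1, h2⟩; exact ⟨⟨h1, h2 ▸ ha⟩, h2⟩
    · intro v hv
      simp at hv ⊢
      exact hv.2
  have hsum : ∑ y ∈ I, (Sy y).card ≤ T.card * s := by
    rw [← Finset.card_biUnion hdisj, ← hTc]
    apply Finset.card_le_card
    intro z hz
    simp only [Sy, Finset.mem_biUnion, Finset.mem_filter] at hz ⊢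
    obtain ⟨_, _, h⟩ := hz
    exact ⟨h.1, h.2.1⟩
  have hsc : ∑ y ∈ I, (T.card + ((B.filter (G.Adj y)).card + 1)) ≤
      ∑ y ∈ I, ((Sy y).card + (K \ A).card) := by
    refine Finset.sum_le_sum fun y hy => ?_
    have := solo_count hN hdeg hA T hTA y (hBm _ (hIB hy)).1 (hBm _ (hIB hy)).2
    rw [← hB] at this
    simp only [Sy]
    omega
  rw [Finset.sum_add_distrib (f := fun _ => T.card), Finset.sum_add_distrib (g := fun _ => (K \ A).card),
    Finset.sum_const, Finset.sum_const, smul_eq_mul, smul_eq_mul] at hsc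
  have hIq : ∑ y ∈ I, ((B.filter (G.Adj y)).card + 1) ≤ I.card * (K \ A).card := by
    have := Finset.sum_le_card_nsmul I (fun y => (B.filter (G.Adj y)).card + 1) (K \ A).card ?_
    · simpa using this
    · intro y hy
      have h1 := deg_split G S c y A B (Finset.filter_subset _ _) (fun w hw => (hBm w hw).2)
        (B_nbr hN hA y (hBm _ (hIB hy)).1 (hBm _ (hIB hy)).2)
      have h2 := hdeg y (hBm _ (hIB hy)).1
      omega
  obtain ⟨j, hj⟩ := Nat.exists_eq_add_of_le hq
  rw [hj] at hsc hsum
  have hIs : s < I.card := by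
    by_contra h
    push Not at h
    have := Nat.mul_le_mul_right (K \ A).card h
    nlinarith
  have := Nat.mul_le_mul_right j hIs.le
  nlinarith

end ctx

lemma near_to_good {G : SimpleGraph V} {S : Finset V} {K : Finset C} {s : ℕ}
    (hdeg : ∀ v ∈ S, (S.filter (G.Adj v)).card < K.card)
    (IH : ∀ K' : Finset C, K'.card < K.card → ∀ S' : Finset V, S'.card = K'.card * s →
      (∀ v ∈ S', (S'.filter (G.Adj v)).card < K'.card) → ∃ c, Good G S' K' s c) :
    ∀ (N : ℕ) (c : V → C) (p p' : C), Near G S K s c p p' →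
      (K.filter (fun a => ¬ Relation.ReflTransGen (Mv G S K c) a p)).card < N →
      ∃ c', Good G S K s c' := by
  intro N
  induction N with
  | zero => intro c p p' _ h; omega
  | succ N ihN =>
    intro c p p' hN hcard
    obtain ⟨A, hA⟩ : ∃ A : Finset C, ∀ a, a ∈ A ↔ a ∈ K ∧ Relation.ReflTransGen (Mv G S K c) a p :=
      ⟨K.filter (fun a => Relation.ReflTransGen (Mv G S K c) a p), fun a => Finset.mem_filter⟩
    by_cases hp'A : p' ∈ A
    · obtain ⟨l, h1, h2, h3⟩ := exists_path ((hA p').1 hp'A).2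
      exact shift l c p' hN h1 h2 h3
    have hpA : p ∈ A := (hA p).2 ⟨hN.hp, .refl⟩
    obtain ⟨U, hU, T, hTA, ⟨W₀, hW₀⟩, hpT, hT, hterm⟩ := exists_terminal A
      (fun a ha => ((hA a).1 ha).2) hpA (not_single hN hdeg hA hp'A)
    by_cases h1 : ∃ W ∈ T, ∃ z ∈ S, c z = W ∧ ∃ y ∈ S, c y ∉ A ∧ Solo G S c y z ∧ ∃ X ∈ A, X ≠ W ∧
        ∀ w ∈ S, c w = X → ¬ G.Adj z w
    · obtain ⟨W, hW, z, hz, hzW, y, hy, hyA, hs, X, hX, hXW, hzX⟩ := h1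
      exact case_one hN hdeg hA hp'A IH W (hTA hW) z hz hzW y hy hyA hs X hX hXW hzX
        (hterm W hW X hX)
    · push Not at h1
      have hq := t_ge_q hN hdeg hA hp'A U T hTA hpT hT W₀ hW₀ (h1 W₀ hW₀)
      obtain ⟨z, hz, hzT, y₁, hy₁, y₂, hy₂, h₁A, h₂A, hne, hnadj, hs₁, hs₂⟩ :=
        exists_pair hN hdeg hA hp'A T hTA hpT hq
      obtain ⟨c', X, hN', b, hbK, hbA, hbacc, hacc⟩ := case_two hN hdeg hA hp'A IH (c z) (hTA hzT)
        (by intro h; exact hpT (h ▸ hzT)) (hterm _ hzT) z hz rfl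
        (h1 (c z) hzT z hz rfl y₁ hy₁ h₁A hs₁) y₁ y₂ hy₁ hy₂ h₁A h₂A hne hnadj hs₁ hs₂
      refine ihN c' p X hN' ?_
      refine lt_of_lt_of_le (Finset.card_lt_card ?_) (Nat.lt_succ_iff.1 hcard)
      rw [Finset.ssubset_iff_of_subset]
      · refine ⟨b, Finset.mem_filter.2 ⟨hbK, fun h => hbA ((hA b).2 ⟨hbK, h⟩)⟩, fun h => ?_⟩
        exact (Finset.mem_filter.1 h).2 hbacc
      · intro a ha
        rw [Finset.mem_filter] at ha ⊢
        exact ⟨ha.1, fun h => ha.2 (hacc a ((hA a).2 ⟨ha.1, h⟩))⟩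

lemma good_bot (s : ℕ) [Nonempty C] (K : Finset C) : ∀ S : Finset V, S.card = K.card * s →
    ∃ c : V → C, (∀ v ∈ S, c v ∈ K) ∧ ∀ a ∈ K, (S.filter (fun v => c v = a)).card = s := by
  induction K using Finset.induction_on with
  | empty =>
    intro S hS
    simp at hS
    subst hS
    exact ⟨fun _ => Classical.arbitrary C, by simp⟩
  | insert a K ha ih =>
    intro S hS
    rw [Finset.card_insert_of_notMem ha, add_mul, one_mul] at hS
    obtain ⟨S', hS', hc⟩ := Finset.exists_subset_card_eq (s := S) (n := s) (by omega)
    obtain ⟨c, h1, h2⟩ := ih (S \ S') (by rw [Finset.card_sdiff_of_subset hS']; omega)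
    refine ⟨fun v => if v ∈ S' then a else c v, ?_, ?_⟩
    · intro v hv
      by_cases h : v ∈ S'
      · simp [h]
      · simp only [h, if_false]
        exact Finset.mem_insert_of_mem (h1 v (Finset.mem_sdiff.2 ⟨hv, h⟩))
    · intro b hb
      by_cases hba : b = a
      · subst hba
        rw [← hc]
        congr 1
        ext v
        simp only [Finset.mem_filter]
        constructor
        · rintro ⟨h3, h4⟩
          by_contra h
          simp only [h, if_false] at h4
          exact ha (h4 ▸ h1 v (Finset.mem_sdiff.2 ⟨h3, h⟩))
        · intro h; exact ⟨hS' h, by simp [h]⟩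
      · rw [← h2 b (Finset.mem_of_mem_insert_of_ne hb hba)]
        congr 1
        ext v
        simp only [Finset.mem_filter, Finset.mem_sdiff]
        by_cases h : v ∈ S'
        · simp [h, Ne.symm hba]
        · simp [h]

def restr (G : SimpleGraph V) (T : Finset V) : SimpleGraph V where
  Adj u v := G.Adj u v ∧ u ∈ T ∧ v ∈ T
  symm := ⟨fun _ _ h => ⟨h.1.symm, h.2.2, h.2.1⟩⟩
  loopless := ⟨fun _ h => h.1.ne rfl⟩

/-- Hajnal–Szemerédi -/
lemma hajnal_szemeredi [Nonempty C] (s : ℕ) : ∀ (k : ℕ) (G : SimpleGraph V) (K : Finset C), K.card = k →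
    ∀ S : Finset V, S.card = K.card * s →
      (∀ v ∈ S, (S.filter (G.Adj v)).card < K.card) → ∃ c, Good G S K s c := by
  intro k
  induction k using Nat.strong_induction_on with
  | _ k ihk =>
  intro G K hKk S hS hdeg
  have main : ∀ T : Finset V, ∃ c, Good (restr G T) S K s c := by
    intro T
    induction T using Finset.induction_on with
    | empty =>
      obtain ⟨c, h1, h2⟩ := good_bot s K S hS
      exact ⟨c, h1, fun u _ v _ h => absurd h.2.1 (by simp), h2⟩
    | insert u T huT ih =>
      obtain ⟨c, hc⟩ := ih
      have hdeg' : ∀ v ∈ S, (S.filter ((restr G (insert u T)).Adj v)).card < K.card := by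
        intro v hv
        refine lt_of_le_of_lt (Finset.card_le_card ?_) (hdeg v hv)
        intro w hw
        rw [Finset.mem_filter] at hw ⊢
        exact ⟨hw.1, hw.2.1⟩
      have hadj : ∀ a b, a ≠ u → b ≠ u → (restr G (insert u T)).Adj a b → (restr G T).Adj a b := by
        rintro a b ha hb ⟨h1, h2, h3⟩
        exact ⟨h1, Finset.mem_of_mem_insert_of_ne h2 ha, Finset.mem_of_mem_insert_of_ne h3 hb⟩
      by_cases huS : u ∈ S
      · obtain ⟨a, ha, han⟩ : ∃ a ∈ K, ∀ w ∈ S, c w = a → ¬ (restr G (insert u T)).Adj u w := by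
          have := lt_of_le_of_lt (Finset.card_image_le (f := c)) (hdeg' u huS)
          obtain ⟨X, hX, hX'⟩ := Finset.exists_mem_notMem_of_card_lt_card this
          exact ⟨X, hX, fun w hw e h => hX' (Finset.mem_image.2 ⟨w, by simp [hw, h], e⟩)⟩
        have hpr : ∀ x ∈ S, ∀ y ∈ S, (restr G (insert u T)).Adj x y →
            Function.update c u a x ≠ Function.update c u a y := by
          intro x hx y hy hxy
          by_cases hxu : x = u
          · subst hxu
            rw [Function.update_self, Function.update_of_ne hxy.ne']
            exact fun e => han y hy e.symm hxy
          · by_cases hyu : y = u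
            · subst hyu
              rw [Function.update_self, Function.update_of_ne hxu]
              exact fun e => han x hx e hxy.symm
            · rw [Function.update_of_ne hxu, Function.update_of_ne hyu]
              exact hc.proper x hx y hy (hadj x y hxu hyu hxy)
        by_cases hau : a = c u
        · refine ⟨c, hc.mem, ?_, hc.card⟩
          rw [hau, Function.update_eq_self] at hpr
          exact hpr
        · refine near_to_good hdeg' (fun K' hK' S' => ihk K'.card (hKk ▸ hK') _ K' rfl S') _
            (Function.update c u a) (c u) a ⟨?_, hpr, hc.mem u huS, ha, ?_⟩ (Nat.lt_succ_self _)
          · intro v hv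
            by_cases hvu : v = u
            · subst hvu; simpa using ha
            · simpa [hvu] using hc.mem v hv
          · intro e he
            have h1 := card_move S c u huS (c u) a rfl hau e
            have h2 := hc.card e he
            omega
      · refine ⟨c, hc.mem, ?_, hc.card⟩
        intro x hx y hy hxy
        exact hc.proper x hx y hy (hadj x y (fun h => huS (h ▸ hx)) (fun h => huS (h ▸ hy)) hxy)
  obtain ⟨c, hc⟩ := main S
  exact ⟨c, hc.mem, fun u hu v hv h => hc.proper u hu v hv ⟨h, hu, hv⟩, hc.card⟩

lemma big_classes {n k s : ℕ} (hk : 0 < k) (hs : k * s ≤ n) (G : SimpleGraph (Fin n))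
    (hdeg : ∀ v, (Finset.univ.filter (G.Adj v)).card < k) :
    ∃ c : Fin n → Fin k, (∀ u v, G.Adj u v → c u ≠ c v) ∧
      ∀ a, s ≤ (Finset.univ.filter (fun v => c v = a)).card := by
  haveI : Nonempty (Fin k) := ⟨⟨0, hk⟩⟩
  obtain ⟨S, -, hS⟩ := Finset.exists_subset_card_eq (s := (Finset.univ : Finset (Fin n)))
    (n := k * s) (by simpa using hs)
  have hle : ∀ (S : Finset (Fin n)) v, (S.filter (G.Adj v)).card < k := fun S v =>
    lt_of_le_of_lt (Finset.card_le_card (Finset.filter_subset_filter _ (Finset.subset_univ _))) (hdeg v)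
  obtain ⟨c₀, hc₀⟩ := hajnal_szemeredi s k G (Finset.univ : Finset (Fin k)) (by simp) S (by simpa using hS)
    (fun v _ => by simpa using hle S v)
  have ext : ∀ T : Finset (Fin n), ∃ c : Fin n → Fin k,
      (∀ u ∈ S ∪ T, ∀ v ∈ S ∪ T, G.Adj u v → c u ≠ c v) ∧
      ∀ a, s ≤ ((S ∪ T).filter (fun v => c v = a)).card := by
    intro T
    induction T using Finset.induction_on with
    | empty =>
      refine ⟨c₀, ?_, ?_⟩
      · simpa using hc₀.proper
      · intro a
        have := hc₀.card a (Finset.mem_univ _)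
        refine le_of_eq ?_
        rw [← this]
        congr 1
        ext v
        simp
    | insert u T huT ih =>
      obtain ⟨c, h1, h2⟩ := ih
      by_cases hu : u ∈ S ∪ T
      · have : S ∪ insert u T = S ∪ T := by rw [Finset.union_insert, Finset.insert_eq_self.2 hu]
        rw [this]; exact ⟨c, h1, h2⟩
      · have hlt : (((S ∪ T).filter (G.Adj u)).image c).card < (Finset.univ : Finset (Fin k)).card := by
          simpa using lt_of_le_of_lt (Finset.card_image_le (f := c)) (hle (S ∪ T) u)
        obtain ⟨X, -, hX⟩ := Finset.exists_mem_notMem_of_card_lt_card hlt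
        have hX' : ∀ w ∈ S ∪ T, c w = X → ¬ G.Adj u w := fun w hw e h =>
          hX (Finset.mem_image.2 ⟨w, Finset.mem_filter.2 ⟨hw, h⟩, e⟩)
        rw [Finset.union_insert]
        refine ⟨Function.update c u X, ?_, ?_⟩
        · intro x hx y hy hxy
          rw [Finset.mem_insert] at hx hy
          by_cases hxu : x = u
          · subst hxu
            have hyx : y ≠ x := hxy.ne'
            rw [Function.update_self, Function.update_of_ne hyx]
            exact fun e => hX' y (hy.resolve_left hyx) e.symm hxy
          · by_cases hyu : y = u
            · subst hyu
              rw [Function.update_self, Function.update_of_ne hxu]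
              exact fun e => hX' x (hx.resolve_left hxu) e hxy.symm
            · rw [Function.update_of_ne hxu, Function.update_of_ne hyu]
              exact h1 x (hx.resolve_left hxu) y (hy.resolve_left hyu) hxy
        · intro a
          refine (h2 a).trans (Finset.card_le_card ?_)
          intro v hv
          rw [Finset.mem_filter] at hv ⊢
          have : v ≠ u := by rintro rfl; exact hu hv.1
          exact ⟨Finset.mem_insert_of_mem hv.1, by rw [Function.update_of_ne this]; exact hv.2⟩
  obtain ⟨c, h1, h2⟩ := ext Finset.univ
  exact ⟨c, fun u v h => h1 u (by simp) v (by simp) h, fun a =>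
    (h2 a).trans (Finset.card_le_card (fun v hv => by
      rw [Finset.mem_filter] at hv ⊢; exact ⟨Finset.mem_univ _, hv.2⟩))⟩

lemma exists_bip {n k d : ℕ} (c : Fin n → Fin k) (f : Fin n → ℕ) (h1 : ∀ v, d ≤ f v)
    (h2 : ∀ v, f v ≤ 2 * d)
    (hc : ∀ a, 9 * d ≤ 4 * (Finset.univ.filter (fun v => c v = a)).card) :
    ∃ R : Fin n → Fin n → Prop, (∀ u w, R u w → c u = c w) ∧
      (∀ u, (Finset.univ.filter (fun w => R u w)).card = f u) ∧
      (∀ w, (Finset.univ.filter (fun u => R u w)).card = f w) := by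
  have := fun a : Fin k => gale_ryser (ι := {v // c v = a}) d (fun v => f v) (fun v => h1 v)
    (fun v => h2 v) (by rw [Fintype.card_subtype]; exact hc a)
  choose Ra hr hcl using this
  obtain ⟨R, hR⟩ : ∃ R : Fin n → Fin n → Prop, ∀ u w, R u w ↔
      ∃ (a : Fin k) (hu : c u = a) (hw : c w = a), Ra a ⟨u, hu⟩ ⟨w, hw⟩ := ⟨_, fun _ _ => Iff.rfl⟩
  refine ⟨R, ?_, ?_, ?_⟩
  · intro u w h
    obtain ⟨a, hu, hw, _⟩ := (hR u w).1 h
    exact hu.trans hw.symm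
  · intro u
    rw [← hr (c u) ⟨u, rfl⟩, ← Finset.card_map (Function.Embedding.subtype _)]
    congr 1
    ext w
    simp only [Finset.mem_filter, Finset.mem_univ, true_and, hR, Finset.mem_map,
      Function.Embedding.coe_subtype]
    constructor
    · rintro ⟨a, rfl, hw, h⟩
      exact ⟨⟨w, hw⟩, h, rfl⟩
    · rintro ⟨⟨w', hw⟩, h, rfl⟩
      exact ⟨_, rfl, hw, h⟩
  · intro w
    rw [← hcl (c w) ⟨w, rfl⟩, ← Finset.card_map (Function.Embedding.subtype _)]
    congr 1
    ext u
    simp only [Finset.mem_filter, Finset.mem_univ, true_and, hR, Finset.mem_map,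
      Function.Embedding.coe_subtype]
    constructor
    · rintro ⟨a, hu, rfl, h⟩
      exact ⟨⟨u, hu⟩, h, rfl⟩
    · rintro ⟨⟨u', hu⟩, h, rfl⟩
      exact ⟨_, hu, rfl, h⟩

def dbl {n : ℕ} (G : SimpleGraph (Fin n)) (R : Fin n → Fin n → Prop) :
    SimpleGraph (Fin n ⊕ Fin n) where
  Adj x y := match x, y with
    | Sum.inl u, Sum.inl v => G.Adj u v
    | Sum.inr u, Sum.inr v => G.Adj u v
    | Sum.inl u, Sum.inr w => R u w
    | Sum.inr w, Sum.inl u => R u w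
  symm := ⟨by rintro (u | u) (v | v) h <;> first | exact G.adj_symm h | exact h⟩
  loopless := ⟨by rintro (u | u) h <;> exact G.irrefl h⟩

lemma regular_aux (n t d D : ℕ) (ht : 0 < t) (G : SimpleGraph (Fin n))
    (htf : G.CliqueFree 3)
    (hind : ∀ s : Finset (Fin n), (∀ u ∈ s, ∀ v ∈ s, u ≠ v → ¬ G.Adj u v) → s.card < t)
    (hdeg1 : ∀ v, (Finset.univ.filter (G.Adj v)).card ≤ D)
    (hdeg2 : ∀ v, D ≤ (Finset.univ.filter (G.Adj v)).card + d)
    (hfloor : 9 * d ≤ 4 * (n / (D + 1))) :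
    ∃ (G' : SimpleGraph (Fin (2 * n))),
      G'.CliqueFree 3 ∧ (∀ v, (Finset.univ.filter (G'.Adj v)).card = d + D) ∧
      ∀ s : Finset (Fin (2 * n)), (∀ u ∈ s, ∀ v ∈ s, u ≠ v → ¬ G'.Adj u v) →
        s.card < 2 * t - 1 := by
  obtain ⟨c, hc1, hc2⟩ := big_classes (k := D + 1) (s := n / (D + 1)) (by omega)
    (Nat.mul_div_le n (D + 1)) G (fun v => Nat.lt_succ_of_le (hdeg1 v))
  obtain ⟨R, hRc, hrow, hcol⟩ := exists_bip (d := d) c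
    (fun v => d + D - (Finset.univ.filter (G.Adj v)).card)
    (fun v => by have := hdeg1 v; omega) (fun v => by have := hdeg2 v; omega)
    (fun a => by have := hc2 a; omega)
  let e : Fin (2 * n) ≃ Fin n ⊕ Fin n := (finCongr (two_mul n)).trans finSumFinEquiv.symm
  obtain ⟨G', hG'⟩ : ∃ G' : SimpleGraph (Fin (2 * n)), ∀ x y, G'.Adj x y ↔
      (dbl G R).Adj (e x) (e y) := ⟨(dbl G R).comap e, fun _ _ => Iff.rfl⟩
  refine ⟨G', ?_, ?_, ?_⟩
  · have htri : ∀ a b c, G.Adj a b → G.Adj a c → G.Adj b c → False := by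
      intro a b c h1 h2 h3
      exact htf {a, b, c} (SimpleGraph.is3Clique_iff.2 ⟨a, b, c, h1, h2, h3, rfl⟩)
    have key : ∀ x y z, (dbl G R).Adj x y → (dbl G R).Adj x z → (dbl G R).Adj y z → False := by
      rintro (x | x) (y | y) (z | z) h1 h2 h3
      · exact htri x y z h1 h2 h3
      · exact hc1 x y h1 ((hRc _ _ h2).trans (hRc _ _ h3).symm)
      · exact hc1 x z h2 ((hRc _ _ h1).trans (hRc _ _ h3).symm)
      · exact hc1 y z h3 ((hRc _ _ h1).symm.trans (hRc _ _ h2))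
      · exact hc1 y z h3 ((hRc _ _ h1).trans (hRc _ _ h2).symm)
      · exact hc1 x z h2 ((hRc _ _ h1).symm.trans (hRc _ _ h3))
      · exact hc1 x y h1 ((hRc _ _ h2).symm.trans (hRc _ _ h3))
      · exact htri x y z h1 h2 h3
    intro s hs
    obtain ⟨a, b, c, h1, h2, h3, -⟩ := SimpleGraph.is3Clique_iff.1 hs
    exact key _ _ _ ((hG' _ _).1 h1) ((hG' _ _).1 h2) ((hG' _ _).1 h3)
  · intro v
    have h1 : (Finset.univ.filter (G'.Adj v)).card =
        ∑ y : Fin n ⊕ Fin n, if (dbl G R).Adj (e v) y then 1 else 0 := by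
      rw [Finset.card_filter, ← Equiv.sum_comp e]
      simp only [hG']
    rw [h1, Fintype.sum_sum_type]
    rcases e v with u | u
    · have := hrow u
      have h2 := hdeg1 u
      rw [Finset.card_filter] at this h2
      have e1 : ∀ y, (dbl G R).Adj (Sum.inl u) (Sum.inl y) ↔ G.Adj u y := fun _ => Iff.rfl
      have e2 : ∀ y, (dbl G R).Adj (Sum.inl u) (Sum.inr y) ↔ R u y := fun _ => Iff.rfl
      simp only [e1, e2, this]
      rw [Finset.card_filter]
      omega
    · have := hcol u
      have h2 := hdeg1 u
      rw [Finset.card_filter] at this h2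
      have e1 : ∀ y, (dbl G R).Adj (Sum.inr u) (Sum.inr y) ↔ G.Adj u y := fun _ => Iff.rfl
      have e2 : ∀ y, (dbl G R).Adj (Sum.inr u) (Sum.inl y) ↔ R y u := fun _ => Iff.rfl
      simp only [e1, e2, this]
      rw [Finset.card_filter]
      omega
  · intro s hs
    have h1 : s.card = (Finset.univ.filter (fun v => e.symm (Sum.inl v) ∈ s)).card +
        (Finset.univ.filter (fun v => e.symm (Sum.inr v) ∈ s)).card := by
      rw [Finset.card_filter, Finset.card_filter,
        ← Fintype.sum_sum_type (fun x => if e.symm x ∈ s then 1 else 0),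
        Equiv.sum_comp e.symm (fun x => if x ∈ s then 1 else 0)]
      simp
    have h2 := hind (Finset.univ.filter (fun v => e.symm (Sum.inl v) ∈ s)) (by
      intro u hu v hv huv hadj
      simp only [Finset.mem_filter, Finset.mem_univ, true_and] at hu hv
      refine hs _ hu _ hv (by simpa using huv) ?_
      rw [hG']
      simp only [Equiv.apply_symm_apply]
      exact hadj)
    have h3 := hind (Finset.univ.filter (fun v => e.symm (Sum.inr v) ∈ s)) (by
      intro u hu v hv huv hadj
      simp only [Finset.mem_filter, Finset.mem_univ, true_and] at hu hv
      refine hs _ hu _ hv (by simpa using huv) ?_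
      rw [hG']
      simp only [Equiv.apply_symm_apply]
      exact hadj)
    omega

end HSpart


/-- If `G` is a triangle-free graph on `n` vertices with independence number less than `t`,
maximum degree `Δ`, minimum degree `δ`, and `Δ - δ ≤ d` with `9 * d ≤ 4 * ⌊n / (Δ + 1)⌋`,
then there is a `(d + Δ)`-regular triangle-free graph on `2n` vertices whose independence
number is less than `2t - 1`. -/
theorem regular_from_almost_regular (n t d : ℕ) (hn : 0 < n) (ht : 0 < t) (hd : 0 < d)
    (G : SimpleGraph (Fin n)) [DecidableRel G.Adj]
    (htf : G.CliqueFree 3)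
    (hind : ∀ s : Finset (Fin n), (∀ u ∈ s, ∀ v ∈ s, u ≠ v → ¬ G.Adj u v) → s.card < t)
    (hdeg : G.maxDegree - G.minDegree ≤ d)
    (hfloor : 9 * d ≤ 4 * (n / (G.maxDegree + 1))) :
    ∃ (G' : SimpleGraph (Fin (2 * n))) (_ : DecidableRel G'.Adj),
      G'.CliqueFree 3 ∧ G'.IsRegularOfDegree (d + G.maxDegree) ∧
      ∀ s : Finset (Fin (2 * n)), (∀ u ∈ s, ∀ v ∈ s, u ≠ v → ¬ G'.Adj u v) →
        s.card < 2 * t - 1 := by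
  classical
  have hdeg' : ∀ v, (Finset.univ.filter (G.Adj v)).card = G.degree v := by
    intro v
    rw [← SimpleGraph.card_neighborFinset_eq_degree, SimpleGraph.neighborFinset_eq_filter]
  obtain ⟨G', h1, h2, h3⟩ := regular_aux n t d G.maxDegree ht G htf hind
    (fun v => by
      have h := G.degree_le_maxDegree v
      rw [← hdeg'] at h
      convert h)
    (fun v => by
      have h := G.minDegree_le_degree v
      rw [← hdeg'] at h
      have h' : G.maxDegree ≤ (Finset.univ.filter (G.Adj v)).card + d := by omega
      convert h')
    hfloor
  refine ⟨G', Classical.decRel _, h1, ?_, h3⟩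
  intro v
  rw [← h2 v, ← SimpleGraph.card_neighborFinset_eq_degree]
  congr 1
  ext w
  simp
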